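/- arXiv:1503.02826 — 7 statements merged into one kernel-verified Lean document; each statement's English description precedes it below -/
import Mathlib

section
/- Under the CFL condition L_F·Δt/Δx ≤ 1/2, if the constraint sequence satisfies q^n ≥ 0 for every n ∈ ℕ and the initial data satisfies 0 ≤ ρ_j^0 ≤ R for every j ∈ ℤ, then the values produced by the constrained finite-volume scheme satisfy 0 ≤ ρ_j^n ≤ R for every j ∈ ℤ and every n ∈ ℕ. -/
/-- L∞ stability of the constrained finite-volume scheme under the CFL condition:
values stay in [0, R]. -/
theorem stmt_0
    (Δx Δt R : ℝ) (hΔx : 0 < Δx) (hΔt : 0 < Δt) (hR : 0 < R)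
    (jc : ℤ)
    (f : ℝ → ℝ) (Lf : ℝ)
    (hfLip : ∀ a b : ℝ, |f a - f b| ≤ Lf * |a - b|)
    (hf0 : f 0 = 0) (hfR : f R = 0)
    (F : ℝ → ℝ → ℝ) (LF : ℝ)
    (hFLip : ∀ a a' b b' : ℝ, |F a b - F a' b'| ≤ LF * (|a - a'| + |b - b'|))
    (hFcons : ∀ a ∈ Set.Icc (0:ℝ) R, F a a = f a)
    (hFmono1 : ∀ a a' b : ℝ, a ∈ Set.Icc (0:ℝ) R → a' ∈ Set.Icc (0:ℝ) R →
      b ∈ Set.Icc (0:ℝ) R → a ≤ a' → F a b ≤ F a' b)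
    (hFmono2 : ∀ a b b' : ℝ, a ∈ Set.Icc (0:ℝ) R → b ∈ Set.Icc (0:ℝ) R →
      b' ∈ Set.Icc (0:ℝ) R → b ≤ b' → F a b' ≤ F a b)
    (hCFL : LF * Δt / Δx ≤ 1/2)
    (q : ℕ → ℝ) (hq : ∀ n, 0 ≤ q n)
    (ρ : ℕ → ℤ → ℝ)
    (hscheme : ∀ n : ℕ, ∀ j : ℤ, ρ (n+1) j =
      ρ n j - (Δt/Δx) *
        ((if j = jc then min (F (ρ n j) (ρ n (j+1))) (q n) else F (ρ n j) (ρ n (j+1)))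
          - (if j - 1 = jc then min (F (ρ n (j-1)) (ρ n j)) (q n)
             else F (ρ n (j-1)) (ρ n j))))
    (hinit : ∀ j : ℤ, 0 ≤ ρ 0 j ∧ ρ 0 j ≤ R) :
    ∀ n : ℕ, ∀ j : ℤ, 0 ≤ ρ n j ∧ ρ n j ≤ R := by
  have h0 : (0:ℝ) ∈ Set.Icc (0:ℝ) R := ⟨le_refl _, hR.le⟩
  have hRR : R ∈ Set.Icc (0:ℝ) R := ⟨hR.le, le_refl _⟩
  have F00 : F 0 0 = 0 := by rw [hFcons 0 h0, hf0]
  have FRR : F R R = 0 := by rw [hFcons R hRR, hfR]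
  have hl : 0 < Δt / Δx := div_pos hΔt hΔx
  have hC : Δt / Δx * LF ≤ 1/2 := by
    have : Δt / Δx * LF = LF * Δt / Δx := by ring
    rw [this]; exact hCFL
  intro n
  induction n with
  | zero => exact hinit
  | succ n ih =>
    intro j
    have ha : ρ n (j-1) ∈ Set.Icc (0:ℝ) R := ih _
    have hb : ρ n j ∈ Set.Icc (0:ℝ) R := ih _
    have hc : ρ n (j+1) ∈ Set.Icc (0:ℝ) R := ih _
    rw [hscheme n j]
    generalize ρ n (j-1) = a at *
    generalize ρ n j = b at *
    generalize ρ n (j+1) = c at *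
    have hqn := hq n
    have e1 : F b c ≤ F b 0 := hFmono2 _ _ _ hb h0 hc hc.1
    have e2 : F b R ≤ F b c := hFmono2 _ _ _ hb hc hRR hc.2
    have e3 : F 0 b ≤ F a b := hFmono1 _ _ _ h0 ha hb ha.1
    have e4 : F a b ≤ F R b := hFmono1 _ _ _ ha hRR hb ha.2
    have e5 : F b R ≤ 0 := (hFmono1 _ _ _ hb hRR hRR hb.2).trans FRR.le
    have e6 : F 0 b ≤ 0 := (hFmono2 _ _ _ h0 h0 hb hb.1).trans F00.le
    have l1 := (le_abs_self _).trans (hFLip b 0 0 0)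
    have l2 := (neg_le_abs _).trans (hFLip 0 0 b 0)
    have l3 := (le_abs_self _).trans (hFLip R R b R)
    have l4 := (neg_le_abs _).trans (hFLip b R R R)
    simp only [sub_self, sub_zero, abs_zero, zero_add, add_zero, F00, FRR,
      abs_of_nonneg hb.1, abs_of_nonpos (sub_nonpos.2 hb.2)] at l1 l2 l3 l4
    have A : ∀ x : ℝ, x = (if j = jc then min (F b c) (q n) else F b c) →
        F b R ≤ x ∧ x ≤ F b 0 := by
      rintro x rfl
      split_ifs
      · exact ⟨le_min e2 (e5.trans hqn), (min_le_left _ _).trans e1⟩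
      · exact ⟨e2, e1⟩
    have B : ∀ x : ℝ, x = (if j - 1 = jc then min (F a b) (q n) else F a b) →
        F 0 b ≤ x ∧ x ≤ F R b := by
      rintro x rfl
      split_ifs
      · exact ⟨le_min e3 (e6.trans hqn), (min_le_left _ _).trans e4⟩
      · exact ⟨e3, e4⟩
    obtain ⟨A1, A2⟩ := A _ rfl
    obtain ⟨B1, B2⟩ := B _ rfl
    generalize (if j = jc then min (F b c) (q n) else F b c) = x at *
    generalize (if j - 1 = jc then min (F a b) (q n) else F a b) = y at *
    have u1 : x - y ≤ 2 * (LF * b) := by linarith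
    have u2 : y - x ≤ 2 * (LF * (R - b)) := by linarith
    have v1 := mul_le_mul_of_nonneg_left u1 hl.le
    have v2 := mul_le_mul_of_nonneg_left u2 hl.le
    have w1 := mul_le_mul_of_nonneg_right hC hb.1
    have w2 := mul_le_mul_of_nonneg_right hC (sub_nonneg.2 hb.2)
    constructor <;> linarith
end

section
/- Under the CFL condition L_F·Δt/Δx ≤ 1/2, one step of the constrained scheme is a monotone map on states with values in [0,R]: for any constraint value q ∈ ℝ and any two states u, v : ℤ → [0,R] with u_j ≤ v_j for all j ∈ ℤ, the updated states H(u) and H(v), defined by H(u)_j = u_j − (Δt/Δx)(g_{j+1/2}(u_j,u_{j+1}) − g_{j−1/2}(u_{j−1},u_j)) with g_{j+1/2}(a,b) = F(a,b) for j ≠ j_c and g_{j_c+1/2}(a,b) = min{F(a,b), q}, satisfy H(u)_j ≤ H(v)_j for all j ∈ ℤ. -/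
/-- One step of the constrained scheme is a monotone map on states with values in [0, R]. -/
theorem stmt_1
    (Δx Δt R : ℝ) (hΔx : 0 < Δx) (hΔt : 0 < Δt) (hR : 0 < R)
    (jc : ℤ)
    (f : ℝ → ℝ) (Lf : ℝ)
    (hfLip : ∀ a b : ℝ, |f a - f b| ≤ Lf * |a - b|)
    (hf0 : f 0 = 0) (hfR : f R = 0)
    (F : ℝ → ℝ → ℝ) (LF : ℝ)
    (hFLip : ∀ a a' b b' : ℝ, |F a b - F a' b'| ≤ LF * (|a - a'| + |b - b'|))
    (hFcons : ∀ a ∈ Set.Icc (0:ℝ) R, F a a = f a)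
    (hFmono1 : ∀ a a' b : ℝ, a ∈ Set.Icc (0:ℝ) R → a' ∈ Set.Icc (0:ℝ) R →
      b ∈ Set.Icc (0:ℝ) R → a ≤ a' → F a b ≤ F a' b)
    (hFmono2 : ∀ a b b' : ℝ, a ∈ Set.Icc (0:ℝ) R → b ∈ Set.Icc (0:ℝ) R →
      b' ∈ Set.Icc (0:ℝ) R → b ≤ b' → F a b' ≤ F a b)
    (hCFL : LF * Δt / Δx ≤ 1/2)
    (q : ℝ)
    (u v : ℤ → ℝ)
    (hu : ∀ j : ℤ, u j ∈ Set.Icc (0:ℝ) R)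
    (hv : ∀ j : ℤ, v j ∈ Set.Icc (0:ℝ) R)
    (huv : ∀ j : ℤ, u j ≤ v j) :
    ∀ j : ℤ,
      u j - (Δt/Δx) *
        ((if j = jc then min (F (u j) (u (j+1))) q else F (u j) (u (j+1)))
          - (if j - 1 = jc then min (F (u (j-1)) (u j)) q else F (u (j-1)) (u j)))
      ≤
      v j - (Δt/Δx) *
        ((if j = jc then min (F (v j) (v (j+1))) q else F (v j) (v (j+1)))
          - (if j - 1 = jc then min (F (v (j-1)) (v j)) q else F (v (j-1)) (v j))) := by
  intro j
  have hd : 0 ≤ v j - u j := sub_nonneg.2 (huv j)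
  have e1 := hFLip (v j) (u j) (u (j+1)) (u (j+1))
  have e2 := hFLip (v (j-1)) (v (j-1)) (v j) (u j)
  rw [sub_self, abs_zero, add_zero, abs_of_nonneg hd] at e1
  rw [sub_self, abs_zero, zero_add, abs_of_nonneg hd] at e2
  have hL : 0 ≤ LF * (v j - u j) := (abs_nonneg _).trans e1
  have a1 := (abs_le.1 e1).2
  have a2 := (abs_le.1 e2).1
  have m1 := hFmono2 (v j) _ _ (hv j) (hu (j+1)) (hv (j+1)) (huv (j+1))
  have m2 := hFmono1 _ _ (u j) (hu (j-1)) (hv (j-1)) (hu j) (huv (j-1))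
  have hmin : ∀ x y c : ℝ, 0 ≤ c → x ≤ y + c → min x q ≤ min y q + c := by
    intro x y c hc h
    rw [← min_add_add_right]
    exact min_le_min h (by linarith)
  have r : (if j = jc then min (F (v j) (v (j+1))) q else F (v j) (v (j+1)))
      ≤ (if j = jc then min (F (u j) (u (j+1))) q else F (u j) (u (j+1)))
        + LF * (v j - u j) := by
    split_ifs
    · exact hmin _ _ _ hL (by linarith)
    · linarith
  have l : (if j - 1 = jc then min (F (u (j-1)) (u j)) q else F (u (j-1)) (u j))
      ≤ (if j - 1 = jc then min (F (v (j-1)) (v j)) q else F (v (j-1)) (v j))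
        + LF * (v j - u j) := by
    split_ifs
    · exact hmin _ _ _ hL (by linarith)
    · linarith
  generalize (if j = jc then min (F (v j) (v (j+1))) q else F (v j) (v (j+1))) = A at *
  generalize (if j = jc then min (F (u j) (u (j+1))) q else F (u j) (u (j+1))) = B at *
  generalize (if j - 1 = jc then min (F (u (j-1)) (u j)) q else F (u (j-1)) (u j)) = C at *
  generalize (if j - 1 = jc then min (F (v (j-1)) (v j)) q else F (v (j-1)) (v j)) = D at *
  have hlam : 0 ≤ Δt / Δx := (div_pos hΔt hΔx).le
  have k1 : Δt / Δx * ((A - D) - (B - C)) ≤ Δt / Δx * (2 * (LF * (v j - u j))) :=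
    mul_le_mul_of_nonneg_left (by linarith) hlam
  have k2 := mul_le_mul_of_nonneg_right hCFL hd
  rw [mul_div_assoc] at k2
  linarith
end

section
/- Under the CFL condition L_F·Δt/Δx ≤ 1/2, the constrained scheme with a common constraint sequence is L¹-contractive: if q^n ≥ 0 for all n, and ρ, ρ̂ are two solutions of the constrained finite-volume scheme with the same constraint sequence q and with initial data taking values in [0,R], and if at some time level n the family (|ρ_j^n − ρ̂_j^n|)_{j∈ℤ} is summable, then the family (|ρ_j^{n+1} − ρ̂_j^{n+1}|)_{j∈ℤ} is summable and Σ_{j∈ℤ} |ρ_j^{n+1} − ρ̂_j^{n+1}| ≤ Σ_{j∈ℤ} |ρ_j^n − ρ̂_j^n|. -/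
lemma aux_mono {R lam LF : ℝ} (hlam : 0 ≤ lam) (hC : LF * lam ≤ 1/2) (G : ℤ → ℝ → ℝ → ℝ)
    (hL : ∀ j a a' b b', |G j a b - G j a' b'| ≤ LF * (|a - a'| + |b - b'|))
    (h1 : ∀ j a a' b, a ∈ Set.Icc (0:ℝ) R → a' ∈ Set.Icc (0:ℝ) R →
      b ∈ Set.Icc (0:ℝ) R → a ≤ a' → G j a b ≤ G j a' b)
    (h2 : ∀ j a b b', a ∈ Set.Icc (0:ℝ) R → b ∈ Set.Icc (0:ℝ) R →
      b' ∈ Set.Icc (0:ℝ) R → b ≤ b' → G j a b' ≤ G j a b)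
    (u v : ℤ → ℝ) (hu : ∀ j, u j ∈ Set.Icc (0:ℝ) R) (hv : ∀ j, v j ∈ Set.Icc (0:ℝ) R)
    (huv : ∀ j, u j ≤ v j) (j : ℤ) :
    u j - lam * (G j (u j) (u (j+1)) - G (j-1) (u (j-1)) (u j)) ≤
    v j - lam * (G j (v j) (v (j+1)) - G (j-1) (v (j-1)) (v j)) := by
  have hd : 0 ≤ v j - u j := sub_nonneg.2 (huv j)
  have e1 := h2 j (v j) _ _ (hv j) (hu (j+1)) (hv (j+1)) (huv (j+1))
  have e2 := (abs_le.1 (hL j (v j) (u j) (u (j+1)) (u (j+1)))).2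
  have e3 := h1 (j-1) _ _ (v j) (hu (j-1)) (hv (j-1)) (hv j) (huv (j-1))
  have e4 := (abs_le.1 (hL (j-1) (u (j-1)) (u (j-1)) (v j) (u j))).1
  simp only [sub_self, abs_zero, add_zero, zero_add, abs_of_nonneg hd] at e2 e4
  have e5 : (G j (v j) (v (j+1)) - G (j-1) (v (j-1)) (v j)) -
      (G j (u j) (u (j+1)) - G (j-1) (u (j-1)) (u j)) ≤ 2 * (LF * (v j - u j)) := by linarith
  have e6 := mul_le_mul_of_nonneg_left e5 hlam
  have e7 := mul_le_mul_of_nonneg_right hC hd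
  nlinarith

lemma aux_contr {R lam LF : ℝ} (hlam : 0 ≤ lam) (hC : LF * lam ≤ 1/2) (G : ℤ → ℝ → ℝ → ℝ)
    (hL : ∀ j a a' b b', |G j a b - G j a' b'| ≤ LF * (|a - a'| + |b - b'|))
    (h1 : ∀ j a a' b, a ∈ Set.Icc (0:ℝ) R → a' ∈ Set.Icc (0:ℝ) R →
      b ∈ Set.Icc (0:ℝ) R → a ≤ a' → G j a b ≤ G j a' b)
    (h2 : ∀ j a b b', a ∈ Set.Icc (0:ℝ) R → b ∈ Set.Icc (0:ℝ) R →
      b' ∈ Set.Icc (0:ℝ) R → b ≤ b' → G j a b' ≤ G j a b)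
    (u v u' v' : ℤ → ℝ) (hu : ∀ j, u j ∈ Set.Icc (0:ℝ) R) (hv : ∀ j, v j ∈ Set.Icc (0:ℝ) R)
    (hu' : ∀ j, u' j = u j - lam * (G j (u j) (u (j+1)) - G (j-1) (u (j-1)) (u j)))
    (hv' : ∀ j, v' j = v j - lam * (G j (v j) (v (j+1)) - G (j-1) (v (j-1)) (v j)))
    (hs : Summable (fun j => |u j - v j|)) :
    Summable (fun j => |u' j - v' j|) ∧ ∑' j, |u' j - v' j| ≤ ∑' j, |u j - v j| := by
  set M : ℤ → ℝ := fun j => max (u j) (v j) with hM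
  set m : ℤ → ℝ := fun j => min (u j) (v j) with hm
  have hMI : ∀ j, M j ∈ Set.Icc (0:ℝ) R := fun j =>
    ⟨le_max_of_le_left (hu j).1, max_le (hu j).2 (hv j).2⟩
  have hmI : ∀ j, m j ∈ Set.Icc (0:ℝ) R := fun j =>
    ⟨le_min (hu j).1 (hv j).1, min_le_of_left_le (hu j).2⟩
  have hMm : ∀ j, M j - m j = |u j - v j| := fun j => max_sub_min_eq_abs' _ _
  let D : ℤ → ℝ := fun j => G j (M j) (M (j+1)) - G j (m j) (m (j+1))
  have hs1 : Summable (fun j : ℤ => |u (j+1) - v (j+1)|) :=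
    hs.comp_injective (i := fun j : ℤ => j + 1) (add_left_injective 1)
  have hD : Summable D := by
    refine Summable.of_norm_bounded ((hs.add hs1).mul_left LF) fun j => ?_
    have := hL j (M j) (m j) (M (j+1)) (m (j+1))
    rwa [hMm, hMm, abs_abs, abs_abs] at this
  have hD1 : Summable (fun j : ℤ => D (j-1)) :=
    hD.comp_injective (i := fun j : ℤ => j - 1) (sub_left_injective)
  have hDe : ∑' j : ℤ, D (j-1) = ∑' j, D j := (Equiv.subRight (1:ℤ)).tsum_eq D
  have key : ∀ j, |u' j - v' j| ≤ |u j - v j| - lam * (D j - D (j-1)) := by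
    intro j
    have a1 := aux_mono hlam hC G hL h1 h2 u M hu hMI (fun j => le_max_left _ _) j
    have a2 := aux_mono hlam hC G hL h1 h2 v M hv hMI (fun j => le_max_right _ _) j
    have a3 := aux_mono hlam hC G hL h1 h2 m u hmI hu (fun j => min_le_left _ _) j
    have a4 := aux_mono hlam hC G hL h1 h2 m v hmI hv (fun j => min_le_right _ _) j
    rw [← hu'] at a1 a3
    rw [← hv'] at a2 a4
    rw [← hMm]
    simp only [D, sub_add_cancel]
    rw [abs_le]
    constructor <;> linarith
  have hS : Summable (fun j => |u j - v j| - lam * (D j - D (j-1))) :=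
    hs.sub ((hD.sub hD1).mul_left lam)
  have hS' : Summable (fun j => |u' j - v' j|) :=
    Summable.of_nonneg_of_le (fun j => abs_nonneg _) key hS
  refine ⟨hS', (hS'.tsum_le_tsum key hS).trans ?_⟩
  rw [hs.tsum_sub ((hD.sub hD1).mul_left lam), tsum_mul_left, hD.tsum_sub hD1, hDe]
  simp

/-- L¹-contractivity of the constrained scheme with a common constraint sequence. -/
theorem stmt_2
    (Δx Δt R : ℝ) (hΔx : 0 < Δx) (hΔt : 0 < Δt) (hR : 0 < R)
    (jc : ℤ)
    (f : ℝ → ℝ) (Lf : ℝ)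
    (hfLip : ∀ a b : ℝ, |f a - f b| ≤ Lf * |a - b|)
    (hf0 : f 0 = 0) (hfR : f R = 0)
    (F : ℝ → ℝ → ℝ) (LF : ℝ)
    (hFLip : ∀ a a' b b' : ℝ, |F a b - F a' b'| ≤ LF * (|a - a'| + |b - b'|))
    (hFcons : ∀ a ∈ Set.Icc (0:ℝ) R, F a a = f a)
    (hFmono1 : ∀ a a' b : ℝ, a ∈ Set.Icc (0:ℝ) R → a' ∈ Set.Icc (0:ℝ) R →
      b ∈ Set.Icc (0:ℝ) R → a ≤ a' → F a b ≤ F a' b)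
    (hFmono2 : ∀ a b b' : ℝ, a ∈ Set.Icc (0:ℝ) R → b ∈ Set.Icc (0:ℝ) R →
      b' ∈ Set.Icc (0:ℝ) R → b ≤ b' → F a b' ≤ F a b)
    (hCFL : LF * Δt / Δx ≤ 1/2)
    (q : ℕ → ℝ) (hq : ∀ n, 0 ≤ q n)
    (ρ ρh : ℕ → ℤ → ℝ)
    (hscheme : ∀ n : ℕ, ∀ j : ℤ, ρ (n+1) j =
      ρ n j - (Δt/Δx) *
        ((if j = jc then min (F (ρ n j) (ρ n (j+1))) (q n) else F (ρ n j) (ρ n (j+1)))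
          - (if j - 1 = jc then min (F (ρ n (j-1)) (ρ n j)) (q n)
             else F (ρ n (j-1)) (ρ n j))))
    (hschemeh : ∀ n : ℕ, ∀ j : ℤ, ρh (n+1) j =
      ρh n j - (Δt/Δx) *
        ((if j = jc then min (F (ρh n j) (ρh n (j+1))) (q n) else F (ρh n j) (ρh n (j+1)))
          - (if j - 1 = jc then min (F (ρh n (j-1)) (ρh n j)) (q n)
             else F (ρh n (j-1)) (ρh n j))))
    (hinit : ∀ j : ℤ, ρ 0 j ∈ Set.Icc (0:ℝ) R)
    (hinith : ∀ j : ℤ, ρh 0 j ∈ Set.Icc (0:ℝ) R)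
    (n : ℕ)
    (hsum : Summable (fun j : ℤ => |ρ n j - ρh n j|)) :
    Summable (fun j : ℤ => |ρ (n+1) j - ρh (n+1) j|) ∧
      (∑' j : ℤ, |ρ (n+1) j - ρh (n+1) j|) ≤ ∑' j : ℤ, |ρ n j - ρh n j| := by
  have hlam : 0 ≤ Δt / Δx := by positivity
  have hC : LF * (Δt / Δx) ≤ 1/2 := by rwa [← mul_div_assoc]
  let G : ℕ → ℤ → ℝ → ℝ → ℝ := fun n j a b => if j = jc then min (F a b) (q n) else F a b
  have hL : ∀ n j a a' b b', |G n j a b - G n j a' b'| ≤ LF * (|a - a'| + |b - b'|) := by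
    intro n j a a' b b'
    refine le_trans ?_ (hFLip a a' b b')
    simp only [G]
    split_ifs
    · simpa using abs_min_sub_min_le_max (F a b) (q n) (F a' b') (q n)
    · exact le_rfl
  have h1 : ∀ n j a a' b, a ∈ Set.Icc (0:ℝ) R → a' ∈ Set.Icc (0:ℝ) R →
      b ∈ Set.Icc (0:ℝ) R → a ≤ a' → G n j a b ≤ G n j a' b := by
    intro n j a a' b ha ha' hb h
    have := hFmono1 a a' b ha ha' hb h
    simp only [G]
    split_ifs
    · exact min_le_min_right _ this
    · exact this
  have h2 : ∀ n j a b b', a ∈ Set.Icc (0:ℝ) R → b ∈ Set.Icc (0:ℝ) R →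
      b' ∈ Set.Icc (0:ℝ) R → b ≤ b' → G n j a b' ≤ G n j a b := by
    intro n j a b b' ha hb hb' h
    have := hFmono2 a b b' ha hb hb' h
    simp only [G]
    split_ifs
    · exact min_le_min_right _ this
    · exact this
  have I0 : (0:ℝ) ∈ Set.Icc (0:ℝ) R := ⟨le_rfl, hR.le⟩
  have IR : R ∈ Set.Icc (0:ℝ) R := ⟨hR.le, le_rfl⟩
  have G0 : ∀ n j, G n j 0 0 = 0 := by
    intro n j
    simp [G, hFcons 0 I0, hf0, hq n]
  have GR : ∀ n j, G n j R R = 0 := by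
    intro n j
    simp [G, hFcons R IR, hfR, hq n]
  have inv : ∀ r : ℕ → ℤ → ℝ, (∀ n j, r (n+1) j = r n j - (Δt/Δx) *
      (G n j (r n j) (r n (j+1)) - G n (j-1) (r n (j-1)) (r n j))) →
      (∀ j, r 0 j ∈ Set.Icc (0:ℝ) R) → ∀ n j, r n j ∈ Set.Icc (0:ℝ) R := by
    intro r hr h0 n
    induction n with
    | zero => exact h0
    | succ k ih =>
      intro j
      have a1 := aux_mono hlam hC (G k) (hL k) (h1 k) (h2 k) (fun _ => 0) (r k)
        (fun _ => I0) ih (fun j => (ih j).1) j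
      have a2 := aux_mono hlam hC (G k) (hL k) (h1 k) (h2 k) (r k) (fun _ => R)
        ih (fun _ => IR) (fun j => (ih j).2) j
      simp only [G0, GR, sub_zero, mul_zero] at a1 a2
      rw [← hr] at a1 a2
      exact ⟨a1, a2⟩
  exact aux_contr hlam hC (G n) (hL n) (h1 n) (h2 n) (ρ n) (ρh n) (ρ (n+1)) (ρh (n+1))
    (inv ρ hscheme hinit n) (inv ρh hschemeh hinith n) (hscheme n) (hschemeh n) hsum
end

section
/- (Discrete stability with respect to the constraint, Proposition in Section 3.2.) Under the CFL condition L_F·Δt/Δx ≤ 1/2, let q, q̂ : ℕ → ℝ be two constraint sequences with q^n ≥ 0 and q̂^n ≥ 0 for all n, and let ρ and ρ̂ be the solutions of the constrained finite-volume scheme associated to q and q̂ respectively, starting from the same initial data ρ^0 = ρ̂^0 with values in [0,R]. Then for every n ≥ 1, Σ_{j∈ℤ} |ρ_j^n − ρ̂_j^n| ≤ 2(Δt/Δx) Σ_{k=0}^{n−1} |q^k − q̂^k|. -/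
/-- Monotone flux on `[0,R]` compatible with the CFL condition. -/
structure GoodFlux (l R : ℝ) (g : ℝ → ℝ → ℝ) : Prop where
  m1 : ∀ a a' b : ℝ, a ∈ Set.Icc (0:ℝ) R → a' ∈ Set.Icc (0:ℝ) R →
      b ∈ Set.Icc (0:ℝ) R → a ≤ a' → g a b ≤ g a' b
  m2 : ∀ a b b' : ℝ, a ∈ Set.Icc (0:ℝ) R → b ∈ Set.Icc (0:ℝ) R →
      b' ∈ Set.Icc (0:ℝ) R → b ≤ b' → g a b' ≤ g a b
  l1 : ∀ a a' b : ℝ, a ≤ a' → l * (g a' b - g a b) ≤ (a' - a) / 2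
  l2 : ∀ a b b' : ℝ, b ≤ b' → l * (g a b - g a b') ≤ (b' - b) / 2

lemma GoodFlux.min_const {l R : ℝ} {g : ℝ → ℝ → ℝ} (hl : 0 ≤ l) (h : GoodFlux l R g) (q : ℝ) :
    GoodFlux l R (fun a b => min (g a b) q) := by
  have key : ∀ x y t : ℝ, 0 ≤ t → l * (x - y) ≤ t → l * (min x q - min y q) ≤ t := by
    intro x y t ht hxy
    rcases le_total x y with hh | hh
    · have : min x q ≤ min y q := min_le_min_right q hh
      nlinarith
    · have : min x q - min y q ≤ x - y := by
        rcases le_total x q with h1 | h1 <;> rcases le_total y q with h2 | h2 <;>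
          simp [h1, h2] <;> linarith
      nlinarith
  refine ⟨?_, ?_, ?_, ?_⟩
  · intro a a' b h1 h2 h3 h4
    exact min_le_min_right q (h.m1 a a' b h1 h2 h3 h4)
  · intro a b b' h1 h2 h3 h4
    exact min_le_min_right q (h.m2 a b b' h1 h2 h3 h4)
  · intro a a' b h1
    exact key _ _ _ (by linarith) (h.l1 a a' b h1)
  · intro a b b' h1
    exact key _ _ _ (by linarith) (h.l2 a b b' h1)

lemma step_mono {l R : ℝ} {g k : ℝ → ℝ → ℝ} (hl : 0 ≤ l) (hg : GoodFlux l R g)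
    (hk : GoodFlux l R k) {a a' b b' c c' : ℝ}
    (ha : a ∈ Set.Icc (0:ℝ) R) (ha' : a' ∈ Set.Icc (0:ℝ) R)
    (hb : b ∈ Set.Icc (0:ℝ) R) (hb' : b' ∈ Set.Icc (0:ℝ) R)
    (hc : c ∈ Set.Icc (0:ℝ) R) (hc' : c' ∈ Set.Icc (0:ℝ) R)
    (haa : a ≤ a') (hbb : b ≤ b') (hcc : c ≤ c') :
    b - l * (g b c - k a b) ≤ b' - l * (g b' c' - k a' b') := by
  have h1 := mul_le_mul_of_nonneg_left (hg.m2 b' c c' hb' hc hc' hcc) hl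
  have h2 := hg.l1 b b' c hbb
  have h3 := mul_le_mul_of_nonneg_left (hk.m1 a a' b ha ha' hb haa) hl
  have h4 := hk.l2 a' b b' hbb
  linarith

/-- The entropy flux. -/
def entF (g : ℝ → ℝ → ℝ) (b b' c c' : ℝ) : ℝ :=
  g (max b b') (max c c') - g (min b b') (min c c')

lemma max_mem' {R a b : ℝ} (ha : a ∈ Set.Icc (0:ℝ) R) (hb : b ∈ Set.Icc (0:ℝ) R) :
    max a b ∈ Set.Icc (0:ℝ) R := ⟨le_max_of_le_left ha.1, max_le ha.2 hb.2⟩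

lemma min_mem' {R a b : ℝ} (ha : a ∈ Set.Icc (0:ℝ) R) (hb : b ∈ Set.Icc (0:ℝ) R) :
    min a b ∈ Set.Icc (0:ℝ) R := ⟨le_min ha.1 hb.1, min_le_of_left_le ha.2⟩

lemma step_entropy {l R : ℝ} {g k : ℝ → ℝ → ℝ} (hl : 0 ≤ l) (hg : GoodFlux l R g)
    (hk : GoodFlux l R k) {a a' b b' c c' : ℝ}
    (ha : a ∈ Set.Icc (0:ℝ) R) (ha' : a' ∈ Set.Icc (0:ℝ) R)
    (hb : b ∈ Set.Icc (0:ℝ) R) (hb' : b' ∈ Set.Icc (0:ℝ) R)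
    (hc : c ∈ Set.Icc (0:ℝ) R) (hc' : c' ∈ Set.Icc (0:ℝ) R) :
    |(b - l * (g b c - k a b)) - (b' - l * (g b' c' - k a' b'))| ≤
      |b - b'| - l * (entF g b b' c c' - entF k a a' b b') := by
  have hMa := max_mem' ha ha'
  have hMb := max_mem' hb hb'
  have hMc := max_mem' hc hc'
  have hma := min_mem' ha ha'
  have hmb := min_mem' hb hb'
  have hmc := min_mem' hc hc'
  have h1 := step_mono hl hg hk ha hMa hb hMb hc hMc
    (le_max_left _ _) (le_max_left _ _) (le_max_left _ _)
  have h2 := step_mono hl hg hk ha' hMa hb' hMb hc' hMc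
    (le_max_right _ _) (le_max_right _ _) (le_max_right _ _)
  have h3 := step_mono hl hg hk hma ha hmb hb hmc hc
    (min_le_left _ _) (min_le_left _ _) (min_le_left _ _)
  have h4 := step_mono hl hg hk hma ha' hmb hb' hmc hc'
    (min_le_right _ _) (min_le_right _ _) (min_le_right _ _)
  have h5 : max b b' - min b b' = |b - b'| := max_sub_min_eq_abs' b b'
  unfold entF
  rw [abs_le]
  constructor <;> linarith

lemma entF_bound {l R : ℝ} {g : ℝ → ℝ → ℝ} (hl : 0 ≤ l) (hg : GoodFlux l R g)
    {b b' c c' : ℝ} (hb : b ∈ Set.Icc (0:ℝ) R) (hb' : b' ∈ Set.Icc (0:ℝ) R)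
    (hc : c ∈ Set.Icc (0:ℝ) R) (hc' : c' ∈ Set.Icc (0:ℝ) R) :
    |l * entF g b b' c c'| ≤ |b - b'| + |c - c'| := by
  have hMb := max_mem' hb hb'
  have hMc := max_mem' hc hc'
  have hmb := min_mem' hb hb'
  have hmc := min_mem' hc hc'
  have h5 : max b b' - min b b' = |b - b'| := max_sub_min_eq_abs' b b'
  have h6 : max c c' - min c c' = |c - c'| := max_sub_min_eq_abs' c c'
  have hbb : min b b' ≤ max b b' := min_le_max
  have hcc : min c c' ≤ max c c' := min_le_max
  have h1 := hg.l1 _ _ (max c c') hbb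
  have h2 := mul_le_mul_of_nonneg_left (hg.m2 _ _ _ hmb hmc hMc hcc) hl
  have h3 := hg.l2 (max b b') _ _ hcc
  have h4 := mul_le_mul_of_nonneg_left (hg.m1 _ _ _ hmb hMb hmc hbb) hl
  have := abs_nonneg (b - b')
  have := abs_nonneg (c - c')
  unfold entF
  rw [abs_le]
  constructor <;> linarith

/-- The constrained flux. -/
def cflux (F : ℝ → ℝ → ℝ) (jc : ℤ) (q : ℝ) (j : ℤ) (a b : ℝ) : ℝ :=
  if j = jc then min (F a b) q else F a b

lemma cflux_good {l R : ℝ} {F : ℝ → ℝ → ℝ} (hl : 0 ≤ l) (h : GoodFlux l R F) (jc : ℤ) (q : ℝ)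
    (j : ℤ) : GoodFlux l R (cflux F jc q j) := by
  by_cases hj : j = jc
  · have : cflux F jc q j = fun a b => min (F a b) q := by
      funext a b; simp [cflux, hj]
    rw [this]; exact h.min_const hl q
  · have : cflux F jc q j = F := by
      funext a b; simp [cflux, hj]
    rw [this]; exact h

lemma cflux_diff (F : ℝ → ℝ → ℝ) (jc : ℤ) (q q' : ℝ) (j : ℤ) (a b : ℝ) :
    |cflux F jc q j a b - cflux F jc q' j a b| ≤ if j = jc then |q - q'| else 0 := by
  by_cases hj : j = jc
  · simp only [cflux, hj, if_true]
    have := abs_min_sub_min_le_max (F a b) q (F a b) q'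
    simpa using this
  · simp [cflux, hj]

set_option maxHeartbeats 1000000 in
lemma one_step {l R : ℝ} {F : ℝ → ℝ → ℝ} (hl : 0 ≤ l) (h : GoodFlux l R F) (jc : ℤ) (q q' : ℝ)
    {u v u' v' : ℤ → ℝ} (hu : ∀ j, u j ∈ Set.Icc (0:ℝ) R) (hv : ∀ j, v j ∈ Set.Icc (0:ℝ) R)
    (hu' : ∀ j, u' j = u j - l * (cflux F jc q j (u j) (u (j+1))
      - cflux F jc q (j-1) (u (j-1)) (u j)))
    (hv' : ∀ j, v' j = v j - l * (cflux F jc q' j (v j) (v (j+1))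
      - cflux F jc q' (j-1) (v (j-1)) (v j)))
    (hs : Summable fun j => |u j - v j|) :
    (Summable fun j => |u' j - v' j|) ∧
    ∑' j, |u' j - v' j| ≤ ∑' j, |u j - v j| + 2 * l * |q - q'| := by
  set P : ℤ → ℝ := fun j => l * entF (cflux F jc q j) (u j) (v j) (u (j+1)) (v (j+1)) with hP
  set e : ℤ → ℝ := fun j => if j = jc then |q - q'| else 0 with he
  have hs1 : Summable fun j => |u (j+1) - v (j+1)| :=
    (Equiv.addRight (1:ℤ)).summable_iff.mpr hs
  have hPs : Summable P := by
    apply Summable.of_norm_bounded (hs.add hs1)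
    intro j
    exact entF_bound hl (cflux_good hl h jc q j) (hu _) (hv _) (hu _) (hv _)
  have hPs1 : Summable fun j => P (j-1) := (Equiv.subRight (1:ℤ)).summable_iff.mpr hPs
  have hPt : ∑' j, P (j-1) = ∑' j, P j := (Equiv.subRight (1:ℤ)).tsum_eq P
  have hes : HasSum e |q - q'| := hasSum_ite_eq jc _
  have hes1 : HasSum (fun j => e (j-1)) |q - q'| := (Equiv.subRight (1:ℤ)).hasSum_iff.mpr hes
  have hpt : ∀ j, |u' j - v' j| ≤ (|u j - v j| - (P j - P (j-1))) + l * (e j + e (j-1)) := by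
    intro j
    have h1 := step_entropy hl (cflux_good hl h jc q j) (cflux_good hl h jc q (j-1))
      (hu (j-1)) (hv (j-1)) (hu j) (hv j) (hu (j+1)) (hv (j+1))
    have h2 := cflux_diff F jc q q' j (v j) (v (j+1))
    have h3 := cflux_diff F jc q q' (j-1) (v (j-1)) (v j)
    have e1 : P (j-1) = l * entF (cflux F jc q (j-1)) (u (j-1)) (v (j-1)) (u j) (v j) := by
      simp only [hP, sub_add_cancel]
    rw [e1, hu' j, hv' j]
    simp only [hP, he]
    rw [abs_le] at h1 h2 h3 ⊢
    have h2a := mul_le_mul_of_nonneg_left h2.1 hl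
    have h2b := mul_le_mul_of_nonneg_left h2.2 hl
    have h3a := mul_le_mul_of_nonneg_left h3.1 hl
    have h3b := mul_le_mul_of_nonneg_left h3.2 hl
    constructor <;> linarith [h1.1, h1.2]
  have hB := (hs.sub (hPs.sub hPs1)).add ((hes.summable.add hes1.summable).mul_left l)
  have hS : Summable fun j => |u' j - v' j| :=
    Summable.of_nonneg_of_le (fun j => abs_nonneg _) hpt hB
  refine ⟨hS, (hS.tsum_le_tsum hpt hB).trans ?_⟩
  have hP1 : HasSum (fun j => P (j-1)) (∑' j, P j) := by
    rw [← hPt]; exact hPs1.hasSum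
  have hT := (hs.hasSum.sub (hPs.hasSum.sub hP1)).add ((hes.add hes1).mul_left l)
  rw [hT.tsum_eq]
  linarith

lemma inv_step {l R : ℝ} {F : ℝ → ℝ → ℝ} (hl : 0 ≤ l) (hR : 0 < R) (h : GoodFlux l R F)
    (h0 : F 0 0 = 0) (hFR : F R R = 0) (jc : ℤ) (q : ℝ) (hq : 0 ≤ q)
    {u u' : ℤ → ℝ} (hu : ∀ j, u j ∈ Set.Icc (0:ℝ) R)
    (hu' : ∀ j, u' j = u j - l * (cflux F jc q j (u j) (u (j+1))
      - cflux F jc q (j-1) (u (j-1)) (u j))) (j : ℤ) : u' j ∈ Set.Icc (0:ℝ) R := by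
  have m0 : (0:ℝ) ∈ Set.Icc (0:ℝ) R := ⟨le_refl _, hR.le⟩
  have mR : R ∈ Set.Icc (0:ℝ) R := ⟨hR.le, le_refl _⟩
  have z0 : ∀ i, cflux F jc q i 0 0 = 0 := by intro i; simp [cflux, h0, hq]
  have zR : ∀ i, cflux F jc q i R R = 0 := by intro i; simp [cflux, hFR, hq]
  have hg := cflux_good hl h jc q j
  have hk := cflux_good hl h jc q (j-1)
  have h1 := step_mono hl hg hk m0 (hu (j-1)) m0 (hu j) m0 (hu (j+1))
    (hu _).1 (hu _).1 (hu _).1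
  have h2 := step_mono hl hg hk (hu (j-1)) mR (hu j) mR (hu (j+1)) mR
    (hu _).2 (hu _).2 (hu _).2
  rw [z0, z0] at h1
  rw [zR, zR] at h2
  rw [hu' j]
  constructor <;> linarith


/-- Discrete stability of the constrained scheme with respect to the constraint. -/
theorem stmt_4
    (Δx Δt R : ℝ) (hΔx : 0 < Δx) (hΔt : 0 < Δt) (hR : 0 < R)
    (jc : ℤ)
    (f : ℝ → ℝ) (Lf : ℝ)
    (hfLip : ∀ a b : ℝ, |f a - f b| ≤ Lf * |a - b|)
    (hf0 : f 0 = 0) (hfR : f R = 0)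
    (F : ℝ → ℝ → ℝ) (LF : ℝ)
    (hFLip : ∀ a a' b b' : ℝ, |F a b - F a' b'| ≤ LF * (|a - a'| + |b - b'|))
    (hFcons : ∀ a ∈ Set.Icc (0:ℝ) R, F a a = f a)
    (hFmono1 : ∀ a a' b : ℝ, a ∈ Set.Icc (0:ℝ) R → a' ∈ Set.Icc (0:ℝ) R →
      b ∈ Set.Icc (0:ℝ) R → a ≤ a' → F a b ≤ F a' b)
    (hFmono2 : ∀ a b b' : ℝ, a ∈ Set.Icc (0:ℝ) R → b ∈ Set.Icc (0:ℝ) R →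
      b' ∈ Set.Icc (0:ℝ) R → b ≤ b' → F a b' ≤ F a b)
    (hCFL : LF * Δt / Δx ≤ 1/2)
    (q qh : ℕ → ℝ) (hq : ∀ n, 0 ≤ q n) (hqh : ∀ n, 0 ≤ qh n)
    (ρ ρh : ℕ → ℤ → ℝ)
    (hscheme : ∀ n : ℕ, ∀ j : ℤ, ρ (n+1) j =
      ρ n j - (Δt/Δx) *
        ((if j = jc then min (F (ρ n j) (ρ n (j+1))) (q n) else F (ρ n j) (ρ n (j+1)))
          - (if j - 1 = jc then min (F (ρ n (j-1)) (ρ n j)) (q n)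
             else F (ρ n (j-1)) (ρ n j))))
    (hschemeh : ∀ n : ℕ, ∀ j : ℤ, ρh (n+1) j =
      ρh n j - (Δt/Δx) *
        ((if j = jc then min (F (ρh n j) (ρh n (j+1))) (qh n) else F (ρh n j) (ρh n (j+1)))
          - (if j - 1 = jc then min (F (ρh n (j-1)) (ρh n j)) (qh n)
             else F (ρh n (j-1)) (ρh n j))))
    (hinit : ∀ j : ℤ, ρ 0 j ∈ Set.Icc (0:ℝ) R)
    (hinit_eq : ∀ j : ℤ, ρ 0 j = ρh 0 j) :
    ∀ n : ℕ, 1 ≤ n →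
      (∑' j : ℤ, |ρ n j - ρh n j|) ≤
        2 * (Δt/Δx) * ∑ k ∈ Finset.range n, |q k - qh k| := by


  have hl : 0 ≤ Δt / Δx := (div_pos hΔt hΔx).le
  have hG : GoodFlux (Δt/Δx) R F := by
    have hC : (Δt / Δx) * LF ≤ 1 / 2 := by
      have : (Δt / Δx) * LF = LF * Δt / Δx := by ring
      rw [this]; exact hCFL
    refine ⟨hFmono1, hFmono2, ?_, ?_⟩
    · intro a a' b hab
      have h1 := (le_abs_self _).trans (hFLip a' a b b)
      rw [sub_self, abs_zero, add_zero, abs_of_nonneg (sub_nonneg.mpr hab)] at h1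
      have h2 := mul_le_mul_of_nonneg_left h1 hl
      have h3 := mul_le_mul_of_nonneg_right hC (sub_nonneg.mpr hab)
      linarith
    · intro a b b' hab
      have h1 := (le_abs_self _).trans (hFLip a a b b')
      rw [sub_self, abs_zero, zero_add, abs_sub_comm,
        abs_of_nonneg (sub_nonneg.mpr hab)] at h1
      have h2 := mul_le_mul_of_nonneg_left h1 hl
      have h3 := mul_le_mul_of_nonneg_right hC (sub_nonneg.mpr hab)
      linarith
  have h0 : F 0 0 = 0 := by rw [hFcons 0 ⟨le_refl _, hR.le⟩, hf0]
  have hFR : F R R = 0 := by rw [hFcons R ⟨hR.le, le_refl _⟩, hfR]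
  have hmem : ∀ n, ∀ j, ρ n j ∈ Set.Icc (0:ℝ) R := by
    intro n
    induction n with
    | zero => exact hinit
    | succ n ih => exact inv_step hl hR hG h0 hFR jc (q n) (hq n) ih (hscheme n)
  have hmemh : ∀ n, ∀ j, ρh n j ∈ Set.Icc (0:ℝ) R := by
    intro n
    induction n with
    | zero => intro j; rw [← hinit_eq j]; exact hinit j
    | succ n ih => exact inv_step hl hR hG h0 hFR jc (qh n) (hqh n) ih (hschemeh n)
  have main : ∀ n : ℕ, (Summable fun j => |ρ n j - ρh n j|) ∧
      (∑' j : ℤ, |ρ n j - ρh n j|) ≤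
        2 * (Δt/Δx) * ∑ k ∈ Finset.range n, |q k - qh k| := by
    intro n
    induction n with
    | zero => simp [hinit_eq, summable_zero]
    | succ n ih =>
      obtain ⟨hs, hle⟩ := one_step hl hG jc (q n) (qh n) (hmem n) (hmemh n)
        (hscheme n) (hschemeh n) ih.1
      refine ⟨hs, hle.trans ?_⟩
      rw [Finset.sum_range_succ]
      linarith [ih.2]
  intro n _
  exact (main n).2
end

section
/- (Space–time L¹ form of the discrete stability estimate, Proposition in Section 3.2.) Under the CFL condition L_F·Δt/Δx ≤ 1/2, let q, q̂ : ℕ → ℝ be two constraint sequences with q^n ≥ 0 and q̂^n ≥ 0 for all n, let ρ and ρ̂ be the solutions of the constrained finite-volume scheme associated to q and q̂ respectively, starting from the same initial data ρ^0 = ρ̂^0 with values in [0,R], and let T > 0 with N = ⌊T/Δt⌋. Then Δt·Δx· Σ_{n=1}^{N} Σ_{j∈ℤ} |ρ_j^n − ρ̂_j^n| ≤ 2T · Δt · Σ_{k=0}^{N−1} |q^k − q̂^k|. -/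
/-- One-variable incremental coefficient. -/
lemma incr_coeff (x y d L : ℝ) (hL : 0 ≤ L) (h : |x - y| ≤ L * |d|)
    (hpos : 0 ≤ d → y ≤ x) (hneg : d ≤ 0 → x ≤ y) :
    ∃ A : ℝ, 0 ≤ A ∧ A ≤ L ∧ x - y = A * d := by
  rcases lt_trichotomy d 0 with hd | hd | hd
  · refine ⟨(x - y) / d, div_nonneg_of_nonpos (by linarith [hneg hd.le]) hd.le, ?_, ?_⟩
    · rw [div_le_iff_of_neg hd]
      rw [abs_of_neg hd] at h
      linarith [neg_abs_le (x - y)]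
    · rw [div_mul_cancel₀ _ hd.ne]
  · refine ⟨0, le_rfl, hL, ?_⟩
    linarith [hpos hd.ge, hneg hd.le]
  · refine ⟨(x - y) / d, div_nonneg (by linarith [hpos hd.le]) hd.le, ?_, ?_⟩
    · rw [div_le_iff₀ hd]
      rw [abs_of_pos hd] at h
      linarith [le_abs_self (x - y)]
    · rw [div_mul_cancel₀ _ hd.ne']

/-- Incremental form of a monotone flux. -/
lemma flux_incr (R L : ℝ) (hL : 0 ≤ L) (g : ℝ → ℝ → ℝ)
    (hLip : ∀ a a' b b' : ℝ, |g a b - g a' b'| ≤ L * (|a - a'| + |b - b'|))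
    (h1 : ∀ a a' b : ℝ, a ∈ Set.Icc (0:ℝ) R → a' ∈ Set.Icc (0:ℝ) R →
      b ∈ Set.Icc (0:ℝ) R → a ≤ a' → g a b ≤ g a' b)
    (h2 : ∀ a b b' : ℝ, a ∈ Set.Icc (0:ℝ) R → b ∈ Set.Icc (0:ℝ) R →
      b' ∈ Set.Icc (0:ℝ) R → b ≤ b' → g a b' ≤ g a b)
    (a a' b b' : ℝ) (ha : a ∈ Set.Icc (0:ℝ) R) (ha' : a' ∈ Set.Icc (0:ℝ) R)
    (hb : b ∈ Set.Icc (0:ℝ) R) (hb' : b' ∈ Set.Icc (0:ℝ) R) :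
    ∃ A B : ℝ, 0 ≤ A ∧ A ≤ L ∧ 0 ≤ B ∧ B ≤ L ∧
      g a b - g a' b' = A * (a - a') - B * (b - b') := by
  obtain ⟨A, hA0, hAL, hA⟩ := incr_coeff (g a b) (g a' b) (a - a') L hL
    (by simpa using hLip a a' b b)
    (fun h => h1 _ _ _ ha' ha hb (by linarith)) (fun h => h1 _ _ _ ha ha' hb (by linarith))
  obtain ⟨B, hB0, hBL, hB⟩ := incr_coeff (g a' b') (g a' b) (b - b') L hL
    (by rw [abs_sub_comm]; simpa using hLip a' a' b b')
    (fun h => h2 _ _ _ ha' hb' hb (by linarith)) (fun h => h2 _ _ _ ha' hb hb' (by linarith))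
  exact ⟨A, B, hA0, hAL, hB0, hBL, by linarith⟩

/-- Incremental form of the monotone scheme. -/
lemma step_incr (R L lam : ℝ) (hL : 0 ≤ L) (hlam : 0 ≤ lam) (hcfl : lam * L ≤ 1 / 2)
    (G : ℤ → ℝ → ℝ → ℝ)
    (hLip : ∀ j, ∀ a a' b b' : ℝ, |G j a b - G j a' b'| ≤ L * (|a - a'| + |b - b'|))
    (h1 : ∀ j, ∀ a a' b : ℝ, a ∈ Set.Icc (0:ℝ) R → a' ∈ Set.Icc (0:ℝ) R →
      b ∈ Set.Icc (0:ℝ) R → a ≤ a' → G j a b ≤ G j a' b)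
    (h2 : ∀ j, ∀ a b b' : ℝ, a ∈ Set.Icc (0:ℝ) R → b ∈ Set.Icc (0:ℝ) R →
      b' ∈ Set.Icc (0:ℝ) R → b ≤ b' → G j a b' ≤ G j a b)
    (u v : ℤ → ℝ) (hu : ∀ j, u j ∈ Set.Icc (0:ℝ) R) (hv : ∀ j, v j ∈ Set.Icc (0:ℝ) R) :
    ∃ A B : ℤ → ℝ, (∀ j, 0 ≤ A j ∧ A j ≤ 1 / 2) ∧ (∀ j, 0 ≤ B j ∧ B j ≤ 1 / 2) ∧
      ∀ j, (u j - lam * (G j (u j) (u (j+1)) - G (j-1) (u (j-1)) (u j)))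
          - (v j - lam * (G j (v j) (v (j+1)) - G (j-1) (v (j-1)) (v j)))
        = (1 - A j - B (j-1)) * (u j - v j) + B j * (u (j+1) - v (j+1))
          + A (j-1) * (u (j-1) - v (j-1)) := by
  choose A B hA0 hAL hB0 hBL h using fun j : ℤ =>
    flux_incr R L hL (G j) (hLip j) (h1 j) (h2 j) (u j) (v j) (u (j+1)) (v (j+1))
      (hu _) (hv _) (hu _) (hv _)
  refine ⟨fun j => lam * A j, fun j => lam * B j,
    fun j => ⟨mul_nonneg hlam (hA0 j), (mul_le_mul_of_nonneg_left (hAL j) hlam).trans hcfl⟩,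
    fun j => ⟨mul_nonneg hlam (hB0 j), (mul_le_mul_of_nonneg_left (hBL j) hlam).trans hcfl⟩, ?_⟩
  intro j
  have e1 := h j
  have e2 := h (j-1)
  rw [sub_add_cancel] at e2
  linear_combination (-lam) * e1 + lam * e2

/-- L¹ contraction. -/
lemma l1_contr (A B e e' : ℤ → ℝ) (hA : ∀ j, 0 ≤ A j ∧ A j ≤ 1 / 2)
    (hB : ∀ j, 0 ≤ B j ∧ B j ≤ 1 / 2)
    (h : ∀ j, e' j = (1 - A j - B (j-1)) * e j + B j * e (j+1) + A (j-1) * e (j-1))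
    (hs : Summable fun j => |e j|) :
    (Summable fun j => |e' j|) ∧ ∑' j, |e' j| ≤ ∑' j, |e j| := by
  have sa : Summable fun j => A j * |e j| :=
    Summable.of_nonneg_of_le (fun j => mul_nonneg (hA j).1 (abs_nonneg _))
      (fun j => by nlinarith [abs_nonneg (e j), (hA j).2]) hs
  have sb : Summable fun j => B (j-1) * |e j| :=
    Summable.of_nonneg_of_le (fun j => mul_nonneg (hB _).1 (abs_nonneg _))
      (fun j => by nlinarith [abs_nonneg (e j), (hB (j-1)).2]) hs
  have sa' : Summable fun j => A (j-1) * |e (j-1)| :=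
    (Equiv.subRight (1:ℤ)).summable_iff.mpr sa
  have ta' : ∑' j, A (j-1) * |e (j-1)| = ∑' j, A j * |e j| :=
    (Equiv.subRight (1:ℤ)).tsum_eq (fun j => A j * |e j|)
  have key : (fun j => B j * |e (j+1)|) =
      (fun j => B (j-1) * |e j|) ∘ (Equiv.addRight (1:ℤ)) := by
    funext j; simp
  have sb' : Summable fun j => B j * |e (j+1)| := by
    rw [key]; exact (Equiv.addRight (1:ℤ)).summable_iff.mpr sb
  have tb' : ∑' j, B j * |e (j+1)| = ∑' j, B (j-1) * |e j| := by
    rw [key]; exact (Equiv.addRight (1:ℤ)).tsum_eq (fun j => B (j-1) * |e j|)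
  have bd : ∀ j, |e' j| ≤ ((|e j| - A j * |e j|) - B (j-1) * |e j|) + B j * |e (j+1)|
      + A (j-1) * |e (j-1)| := by
    intro j
    rw [h j]
    refine (abs_add_le _ _).trans ?_
    refine (add_le_add_left (abs_add_le _ _) _).trans ?_
    rw [abs_mul, abs_mul, abs_mul, abs_of_nonneg (hB j).1, abs_of_nonneg (hA (j-1)).1,
      abs_of_nonneg (by linarith [(hA j).2, (hB (j-1)).2] : 0 ≤ 1 - A j - B (j-1))]
    apply le_of_eq; ring
  have S1 := hs.sub sa
  have S2 := S1.sub sb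
  have S3 := S2.add sb'
  have S4 := S3.add sa'
  have s' : Summable fun j => |e' j| := Summable.of_nonneg_of_le (fun j => abs_nonneg _) bd S4
  refine ⟨s', (s'.tsum_le_tsum bd S4).trans ?_⟩
  rw [S3.tsum_add sa', S2.tsum_add sb', S1.tsum_sub sb, hs.tsum_sub sa, ta', tb']
  linarith

/-- The constrained flux. -/
noncomputable def Gq (F : ℝ → ℝ → ℝ) (jc : ℤ) (q : ℝ) (j : ℤ) (a b : ℝ) : ℝ :=
  if j = jc then min (F a b) q else F a b

lemma Gq_lip (F : ℝ → ℝ → ℝ) (jc : ℤ) (L q : ℝ)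
    (hLip : ∀ a a' b b' : ℝ, |F a b - F a' b'| ≤ L * (|a - a'| + |b - b'|)) :
    ∀ j, ∀ a a' b b' : ℝ, |Gq F jc q j a b - Gq F jc q j a' b'| ≤ L * (|a - a'| + |b - b'|) := by
  intro j a a' b b'
  unfold Gq
  split_ifs
  · refine (abs_min_sub_min_le_max _ _ _ _).trans ?_
    simpa using hLip a a' b b'
  · exact hLip a a' b b'

lemma Gq_mono (F : ℝ → ℝ → ℝ) (jc : ℤ) (q : ℝ) (j : ℤ) (a b a' b' : ℝ)
    (h : F a b ≤ F a' b') : Gq F jc q j a b ≤ Gq F jc q j a' b' := by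
  unfold Gq
  split_ifs
  · exact min_le_min_right _ h
  · exact h

/-- Space–time L¹ form of the discrete stability estimate with respect to the constraint. -/
theorem stmt_5
    (Δx Δt R : ℝ) (hΔx : 0 < Δx) (hΔt : 0 < Δt) (hR : 0 < R)
    (jc : ℤ)
    (f : ℝ → ℝ) (Lf : ℝ)
    (hfLip : ∀ a b : ℝ, |f a - f b| ≤ Lf * |a - b|)
    (hf0 : f 0 = 0) (hfR : f R = 0)
    (F : ℝ → ℝ → ℝ) (LF : ℝ)
    (hFLip : ∀ a a' b b' : ℝ, |F a b - F a' b'| ≤ LF * (|a - a'| + |b - b'|))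
    (hFcons : ∀ a ∈ Set.Icc (0:ℝ) R, F a a = f a)
    (hFmono1 : ∀ a a' b : ℝ, a ∈ Set.Icc (0:ℝ) R → a' ∈ Set.Icc (0:ℝ) R →
      b ∈ Set.Icc (0:ℝ) R → a ≤ a' → F a b ≤ F a' b)
    (hFmono2 : ∀ a b b' : ℝ, a ∈ Set.Icc (0:ℝ) R → b ∈ Set.Icc (0:ℝ) R →
      b' ∈ Set.Icc (0:ℝ) R → b ≤ b' → F a b' ≤ F a b)
    (hCFL : LF * Δt / Δx ≤ 1/2)
    (q qh : ℕ → ℝ) (hq : ∀ n, 0 ≤ q n) (hqh : ∀ n, 0 ≤ qh n)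
    (ρ ρh : ℕ → ℤ → ℝ)
    (hscheme : ∀ n : ℕ, ∀ j : ℤ, ρ (n+1) j =
      ρ n j - (Δt/Δx) *
        ((if j = jc then min (F (ρ n j) (ρ n (j+1))) (q n) else F (ρ n j) (ρ n (j+1)))
          - (if j - 1 = jc then min (F (ρ n (j-1)) (ρ n j)) (q n)
             else F (ρ n (j-1)) (ρ n j))))
    (hschemeh : ∀ n : ℕ, ∀ j : ℤ, ρh (n+1) j =
      ρh n j - (Δt/Δx) *
        ((if j = jc then min (F (ρh n j) (ρh n (j+1))) (qh n) else F (ρh n j) (ρh n (j+1)))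
          - (if j - 1 = jc then min (F (ρh n (j-1)) (ρh n j)) (qh n)
             else F (ρh n (j-1)) (ρh n j))))
    (hinit : ∀ j : ℤ, ρ 0 j ∈ Set.Icc (0:ℝ) R)
    (hinit_eq : ∀ j : ℤ, ρ 0 j = ρh 0 j)
    (T : ℝ) (hT : 0 < T)
    (N : ℕ) (hN : N = ⌊T / Δt⌋₊) :
    Δt * Δx * ∑ n ∈ Finset.Icc 1 N, ∑' j : ℤ, |ρ n j - ρh n j| ≤
      2 * T * (Δt * ∑ k ∈ Finset.range N, |q k - qh k|) := by
  have hlam : 0 ≤ Δt / Δx := (div_pos hΔt hΔx).le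
  have hL : 0 ≤ LF := by
    have := hFLip 1 0 0 0
    norm_num at this
    exact (abs_nonneg _).trans this
  have hcfl : Δt / Δx * LF ≤ 1 / 2 := by
    calc Δt / Δx * LF = LF * Δt / Δx := by ring
      _ ≤ _ := hCFL
  have m1 := fun (p : ℝ) (j : ℤ) (a a' b : ℝ) (ha : a ∈ Set.Icc (0:ℝ) R)
    (ha' : a' ∈ Set.Icc (0:ℝ) R) (hb : b ∈ Set.Icc (0:ℝ) R) (h : a ≤ a') =>
      Gq_mono F jc p j a b a' b (hFmono1 a a' b ha ha' hb h)
  have m2 := fun (p : ℝ) (j : ℤ) (a b b' : ℝ) (ha : a ∈ Set.Icc (0:ℝ) R)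
    (hb : b ∈ Set.Icc (0:ℝ) R) (hb' : b' ∈ Set.Icc (0:ℝ) R) (h : b ≤ b') =>
      Gq_mono F jc p j a b' a b (hFmono2 a b b' ha hb hb' h)
  have hstep := fun (p : ℝ) => step_incr R LF (Δt / Δx) hL hlam hcfl (Gq F jc p)
    (Gq_lip F jc LF p hFLip) (m1 p) (m2 p)
  have mem0 : (0:ℝ) ∈ Set.Icc (0:ℝ) R := ⟨le_rfl, hR.le⟩
  have memR : R ∈ Set.Icc (0:ℝ) R := ⟨hR.le, le_rfl⟩
  have F00 : F 0 0 = 0 := (hFcons 0 mem0).trans hf0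
  have FRR : F R R = 0 := (hFcons R memR).trans hfR
  -- invariance of [0,R] in one step
  have hinv : ∀ p : ℝ, 0 ≤ p → ∀ u : ℤ → ℝ, (∀ j, u j ∈ Set.Icc (0:ℝ) R) → ∀ j,
      (u j - (Δt / Δx) * (Gq F jc p j (u j) (u (j+1)) - Gq F jc p (j-1) (u (j-1)) (u j)))
        ∈ Set.Icc (0:ℝ) R := by
    intro p hp u hu j
    have G0 : ∀ i, Gq F jc p i 0 0 = 0 := by
      intro i; simp [Gq, F00, hp]
    have GR : ∀ i, Gq F jc p i R R = 0 := by
      intro i; simp [Gq, FRR, hp]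
    constructor
    · obtain ⟨A, B, hA, hB, h⟩ := hstep p u (fun _ => 0) hu (fun _ => mem0)
      have := h j
      simp only [G0] at this
      have t1 := mul_nonneg (by linarith [(hA j).2, (hB (j-1)).2] : 0 ≤ 1 - A j - B (j-1)) (hu j).1
      have t2 := mul_nonneg (hB j).1 (hu (j+1)).1
      have t3 := mul_nonneg (hA (j-1)).1 (hu (j-1)).1
      simp only [sub_zero, mul_zero] at this
      linarith
    · obtain ⟨A, B, hA, hB, h⟩ := hstep p u (fun _ => R) hu (fun _ => memR)
      have := h j
      simp only [GR] at this
      have t1 := mul_nonneg (by linarith [(hA j).2, (hB (j-1)).2] : 0 ≤ 1 - A j - B (j-1))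
        (sub_nonneg.2 (hu j).2)
      have t2 := mul_nonneg (hB j).1 (sub_nonneg.2 (hu (j+1)).2)
      have t3 := mul_nonneg (hA (j-1)).1 (sub_nonneg.2 (hu (j-1)).2)
      simp only [sub_zero, mul_zero] at this
      linarith
  have sch : ∀ n j, ρ (n+1) j = ρ n j - (Δt / Δx) *
      (Gq F jc (q n) j (ρ n j) (ρ n (j+1)) - Gq F jc (q n) (j-1) (ρ n (j-1)) (ρ n j)) := hscheme
  have schh : ∀ n j, ρh (n+1) j = ρh n j - (Δt / Δx) *
      (Gq F jc (qh n) j (ρh n j) (ρh n (j+1))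
        - Gq F jc (qh n) (j-1) (ρh n (j-1)) (ρh n j)) := hschemeh
  have inv : ∀ n j, ρ n j ∈ Set.Icc (0:ℝ) R := by
    intro n
    induction n with
    | zero => exact hinit
    | succ n ih => intro j; rw [sch]; exact hinv _ (hq n) _ ih j
  have invh : ∀ n j, ρh n j ∈ Set.Icc (0:ℝ) R := by
    intro n
    induction n with
    | zero => intro j; rw [← hinit_eq]; exact hinit j
    | succ n ih => intro j; rw [schh]; exact hinv _ (hqh n) _ ih j
  -- one-step and accumulated L¹ bound
  have main : ∀ n, (Summable fun j => |ρ n j - ρh n j|) ∧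
      ∑' j, |ρ n j - ρh n j| ≤ 2 * (Δt / Δx) * ∑ k ∈ Finset.range n, |q k - qh k| := by
    intro n
    induction n with
    | zero => simp [hinit_eq, summable_zero]
    | succ n ih =>
      obtain ⟨hs, hle⟩ := ih
      obtain ⟨A, B, hA, hB, h⟩ := hstep (q n) (ρ n) (ρh n) (inv n) (invh n)
      obtain ⟨cs, cle⟩ := l1_contr A B (fun j => ρ n j - ρh n j) _ hA hB h hs
      set D : ℝ := Δt / Δx * |q n - qh n| with hD
      have hD0 : 0 ≤ D := mul_nonneg hlam (abs_nonneg _)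
      have z1 : HasSum (fun j : ℤ => if j = jc then D else 0) D := hasSum_ite_eq jc D
      have z2 : HasSum (fun j : ℤ => if j = jc + 1 then D else 0) D := hasSum_ite_eq (jc+1) D
      have z := cs.hasSum.add (z1.add z2)
      have Gd : ∀ j a b, Δt / Δx * |Gq F jc (q n) j a b - Gq F jc (qh n) j a b|
          ≤ if j = jc then D else 0 := by
        intro j a b
        unfold Gq
        split_ifs with hj
        · refine mul_le_mul_of_nonneg_left ?_ hlam
          refine (abs_min_sub_min_le_max _ _ _ _).trans ?_
          simp
        · simp
      have bd : ∀ j, |ρ (n+1) j - ρh (n+1) j| ≤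
          |(ρ n j - (Δt / Δx) * (Gq F jc (q n) j (ρ n j) (ρ n (j+1))
              - Gq F jc (q n) (j-1) (ρ n (j-1)) (ρ n j)))
            - (ρh n j - (Δt / Δx) * (Gq F jc (q n) j (ρh n j) (ρh n (j+1))
              - Gq F jc (q n) (j-1) (ρh n (j-1)) (ρh n j)))|
          + ((if j = jc then D else 0) + (if j = jc + 1 then D else 0)) := by
        intro j
        have g1 := Gd j (ρh n j) (ρh n (j+1))
        have g2 := Gd (j-1) (ρh n (j-1)) (ρh n j)
        simp only [sub_eq_iff_eq_add] at g2
        rw [← abs_of_nonneg hlam, ← abs_mul] at g1 g2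
        rw [sch, schh]
        have tri : ∀ x y w1 w2 : ℝ, |x - y - w1 + w2| ≤ |x - y| + (|w1| + |w2|) := by
          intro x y w1 w2
          linarith [abs_add_le (x - y - w1) w2, abs_sub (x - y) w1]
        refine le_trans (le_of_eq ?_) ((tri _ _ _ _).trans (add_le_add_right (add_le_add g1 g2) _))
        congr 1; ring
      have s' := Summable.of_nonneg_of_le (fun j => abs_nonneg _) bd z.summable
      refine ⟨s', (s'.tsum_le_tsum bd z.summable).trans ?_⟩
      rw [z.tsum_eq, Finset.sum_range_succ, mul_add]
      have := cle.trans hle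
      linarith
  have hS0 : 0 ≤ ∑ k ∈ Finset.range N, |q k - qh k| := Finset.sum_nonneg fun _ _ => abs_nonneg _
  have hsum : ∑ n ∈ Finset.Icc 1 N, ∑' j : ℤ, |ρ n j - ρh n j| ≤
      N * (2 * (Δt / Δx) * ∑ k ∈ Finset.range N, |q k - qh k|) := by
    have := Finset.sum_le_card_nsmul (Finset.Icc 1 N) (fun n => ∑' j : ℤ, |ρ n j - ρh n j|)
      (2 * (Δt / Δx) * ∑ k ∈ Finset.range N, |q k - qh k|) (by
        intro n hn
        refine (main n).2.trans (mul_le_mul_of_nonneg_left ?_ (by positivity))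
        exact Finset.sum_le_sum_of_subset_of_nonneg
          (Finset.range_mono (Finset.mem_Icc.1 hn).2) (fun _ _ _ => abs_nonneg _))
    simpa using this
  have hNT : (N:ℝ) * Δt ≤ T := by
    rw [← le_div_iff₀ hΔt, hN]
    exact Nat.floor_le (by positivity)
  set S := ∑ k ∈ Finset.range N, |q k - qh k|
  calc _ ≤ Δt * Δx * (N * (2 * (Δt / Δx) * S)) :=
        mul_le_mul_of_nonneg_left hsum (by positivity)
    _ = 2 * (N * Δt) * (Δt * S) := by field_simp
    _ ≤ _ := by gcongr
end

section
/- (One-step oscillation bound for the non-local constraint, from the proof of the BV estimate.) Let w : ℤ → ℝ be nonnegative with w_j = 0 whenever j < j_w or j > j_c, let p : ℝ → ℝ be Lipschitz with constant L_p, and define q^n = p(Δx · Σ_{j=j_w}^{j_c} w_j ρ_j^n) along a solution ρ of the constrained finite-volume scheme with constraint sequence (q^n). Then for every n ∈ ℕ, |q^{n+1} − q^n| ≤ Δt · L_p · (sup_{j} w_j) · Σ_{j=j_w−1}^{j_c} |𝓕^n_{j+1/2}|, where 𝓕^n_{j+1/2} denotes the (constrained) numerical flux at interface j+1/2 and time level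 n. -/
/-- One-step oscillation bound for the discretized non-local constraint. -/
theorem stmt_7
    (Δx Δt : ℝ) (hΔx : 0 < Δx) (hΔt : 0 < Δt)
    (jc jw : ℤ) (hjw : jw ≤ jc)
    (F : ℝ → ℝ → ℝ)
    (w : ℤ → ℝ) (hw_nonneg : ∀ j, 0 ≤ w j)
    (hw_supp : ∀ j : ℤ, (j < jw ∨ jc < j) → w j = 0)
    (p : ℝ → ℝ) (Lp : ℝ)
    (hpLip : ∀ x y : ℝ, |p x - p y| ≤ Lp * |x - y|)
    (q : ℕ → ℝ) (ρ : ℕ → ℤ → ℝ)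
    (hq : ∀ n : ℕ, q n = p (Δx * ∑ j ∈ Finset.Icc jw jc, w j * ρ n j))
    (hscheme : ∀ n : ℕ, ∀ j : ℤ, ρ (n+1) j =
      ρ n j - (Δt/Δx) *
        ((if j = jc then min (F (ρ n j) (ρ n (j+1))) (q n) else F (ρ n j) (ρ n (j+1)))
          - (if j - 1 = jc then min (F (ρ n (j-1)) (ρ n j)) (q n)
             else F (ρ n (j-1)) (ρ n j)))) :
    ∀ n : ℕ, |q (n+1) - q n| ≤
      Δt * Lp * (⨆ j : ℤ, w j) *
        ∑ j ∈ Finset.Icc (jw - 1) jc,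
          |if j = jc then min (F (ρ n j) (ρ n (j+1))) (q n) else F (ρ n j) (ρ n (j+1))| := by
  intro n
  obtain ⟨G, hG⟩ : ∃ G : ℤ → ℝ, ∀ j, G j =
      if j = jc then min (F (ρ n j) (ρ n (j+1))) (q n) else F (ρ n j) (ρ n (j+1)) :=
    ⟨_, fun _ => rfl⟩
  have hs : ∀ j, ρ (n+1) j = ρ n j - (Δt/Δx) * (G j - G (j-1)) := by
    intro j
    rw [hscheme n j, hG j, hG (j-1), sub_add_cancel]
  simp only [← hG]
  have hLp : 0 ≤ Lp := by
    have h := hpLip 1 0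
    have h2 := abs_nonneg (p 1 - p 0)
    norm_num at h
    linarith
  have hbdd : BddAbove (Set.range w) := by
    have hfin : (Set.range w).Finite := by
      refine (((Finset.Icc jw jc).image w ∪ {0}).finite_toSet).subset ?_
      rintro _ ⟨j, rfl⟩
      by_cases hj : j < jw ∨ jc < j
      · simp [hw_supp j hj]
      · push Not at hj
        simp only [Finset.coe_union, Finset.coe_image, Finset.coe_Icc]
        exact Or.inl ⟨j, ⟨hj.1, hj.2⟩, rfl⟩
    exact hfin.bddAbove
  have hle : ∀ j, w j ≤ ⨆ j : ℤ, w j := fun j => le_ciSup hbdd j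
  generalize (⨆ j : ℤ, w j) = M at hle
  have h1 : ∑ j ∈ Finset.Icc jw jc, w j * G j = ∑ j ∈ Finset.Icc (jw-1) jc, w j * G j := by
    apply Finset.sum_subset
    · apply Finset.Icc_subset_Icc <;> omega
    · intro j hj hj'
      simp only [Finset.mem_Icc] at hj hj'
      rw [hw_supp j (by omega), zero_mul]
  have h2 : ∑ j ∈ Finset.Icc jw jc, w j * G (j-1)
      = ∑ j ∈ Finset.Icc (jw-1) jc, w (j+1) * G j := by
    trans ∑ j ∈ Finset.Icc (jw-1) (jc-1), w (j+1) * G j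
    · apply Finset.sum_nbij' (fun j => j - 1) (fun j => j + 1)
      · intro j hj
        simp only [Finset.mem_Icc] at *
        omega
      · intro j hj
        simp only [Finset.mem_Icc] at *
        omega
      · intro j _
        simp
      · intro j _
        simp
      · intro j _
        simp
    · apply Finset.sum_subset
      · apply Finset.Icc_subset_Icc <;> omega
      · intro j hj hj'
        simp only [Finset.mem_Icc] at hj hj'
        rw [hw_supp (j+1) (by omega), zero_mul]
  have h3 : Δx * ∑ j ∈ Finset.Icc jw jc, w j * ρ (n+1) j
      - Δx * ∑ j ∈ Finset.Icc jw jc, w j * ρ n j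
      = - (Δt * ∑ j ∈ Finset.Icc (jw-1) jc, (w j - w (j+1)) * G j) := by
    simp only [sub_mul, Finset.sum_sub_distrib]
    rw [← h1, ← h2, ← mul_sub, ← Finset.sum_sub_distrib, ← Finset.sum_sub_distrib,
      Finset.mul_sum, Finset.mul_sum, ← Finset.sum_neg_distrib]
    refine Finset.sum_congr rfl fun j _ => ?_
    rw [hs j]
    field_simp
    ring
  have h4 : |∑ j ∈ Finset.Icc (jw-1) jc, (w j - w (j+1)) * G j|
      ≤ M * ∑ j ∈ Finset.Icc (jw-1) jc, |G j| := by
    rw [Finset.mul_sum]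
    refine (Finset.abs_sum_le_sum_abs _ _).trans (Finset.sum_le_sum fun j _ => ?_)
    rw [abs_mul]
    refine mul_le_mul_of_nonneg_right ?_ (abs_nonneg _)
    rw [abs_le]
    constructor <;> linarith [hle j, hle (j+1), hw_nonneg j, hw_nonneg (j+1)]
  rw [hq (n+1), hq n]
  refine (hpLip _ _).trans ?_
  rw [h3, abs_neg, abs_mul, abs_of_pos hΔt]
  calc _ ≤ Lp * (Δt * (M * ∑ j ∈ Finset.Icc (jw-1) jc, |G j|)) := by gcongr
    _ = _ := by ring
end

section
/- (BV estimate on the discretized non-local constraint, Proposition in Section 3.2.) Assume the CFL condition L_F·Δt/Δx ≤ 1/2 and initial data ρ^0 with values in [0,R]. Let w : ℤ → ℝ be nonnegative and bounded with w_j = 0 whenever j < j_w or j > j_c, let p : ℝ → ℝ be Lipschitz with constant L_p and nonnegative, and let ρ be the solution of the constrained finite-volume scheme whose constraint sequence is defined self-consistently by q^n = p(Δx · Σ_{j=j_w}^{j_c} w_j ρ_j^n). Then for every T > 0, with N = ⌊T/Δt⌋, Σ_{n=0}^{N−1} |q^{n+1} − q^n| ≤ (j_c − j_w + 2) · T ·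 R · L_p · (sup_j w_j) · (L_F + L_f). -/
/-- Discrete summation by parts bound. -/
theorem abel_bound (jc jw : ℤ) (hjw : jw ≤ jc) (w G : ℤ → ℝ) (W M : ℝ)
    (hw0 : ∀ j, 0 ≤ w j) (hwW : ∀ j, w j ≤ W)
    (hs : ∀ j : ℤ, (j < jw ∨ jc < j) → w j = 0) (hG : ∀ j, |G j| ≤ M) :
    |∑ j ∈ Finset.Icc jw jc, w j * (G j - G (j-1))| ≤ ((jc - jw + 2 : ℤ) : ℝ) * (W * M) := by
  have h1 : ∑ j ∈ Finset.Icc jw jc, w j * G j = ∑ j ∈ Finset.Icc (jw-1) jc, w j * G j := by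
    apply Finset.sum_subset
    · intro x hx
      simp only [Finset.mem_Icc] at *
      omega
    · intro x hx hx'
      simp only [Finset.mem_Icc] at *
      rw [hs x (by omega), zero_mul]
  have h2 : ∑ j ∈ Finset.Icc jw jc, w j * G (j-1)
      = ∑ j ∈ Finset.Icc (jw-1) jc, w (j+1) * G j := by
    have h3 : ∑ j ∈ Finset.Icc jw jc, w j * G (j-1)
        = ∑ j ∈ Finset.Icc (jw-1) (jc-1), w (j+1) * G j := by
      apply Finset.sum_bij' (fun j _ => j - 1) (fun j _ => j + 1)
      all_goals intro x hx
      all_goals simp at hx ⊢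
      all_goals omega
    rw [h3]
    apply Finset.sum_subset
    · intro x hx
      simp only [Finset.mem_Icc] at *
      omega
    · intro x hx hx'
      simp only [Finset.mem_Icc] at *
      rw [hs (x+1) (by omega), zero_mul]
  have h4 : ∑ j ∈ Finset.Icc jw jc, w j * (G j - G (j-1))
      = ∑ j ∈ Finset.Icc (jw-1) jc, (w j - w (j+1)) * G j := by
    simp only [mul_sub, sub_mul, Finset.sum_sub_distrib, h1, h2]
  rw [h4]
  have hcard : ((Finset.Icc (jw-1) jc).card : ℝ) = ((jc - jw + 2 : ℤ) : ℝ) := by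
    have : ((Finset.Icc (jw-1) jc).card : ℤ) = jc - jw + 2 := by
      rw [Int.card_Icc]
      omega
    exact_mod_cast this
  calc |∑ j ∈ Finset.Icc (jw-1) jc, (w j - w (j+1)) * G j|
      ≤ ∑ j ∈ Finset.Icc (jw-1) jc, |(w j - w (j+1)) * G j| := Finset.abs_sum_le_sum_abs _ _
    _ ≤ ∑ j ∈ Finset.Icc (jw-1) jc, W * M := by
        apply Finset.sum_le_sum
        intro j _
        rw [abs_mul]
        have : |w j - w (j+1)| ≤ W := by
          rw [abs_le]
          constructor <;> linarith [hw0 j, hw0 (j+1), hwW j, hwW (j+1)]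
        exact mul_le_mul this (hG j) (abs_nonneg _) ((hw0 j).trans (hwW j))
    _ = _ := by rw [Finset.sum_const, nsmul_eq_mul, hcard]

/-- BV estimate on the discretized non-local constraint. -/
theorem stmt_8
    (Δx Δt R : ℝ) (hΔx : 0 < Δx) (hΔt : 0 < Δt) (hR : 0 < R)
    (jc jw : ℤ) (hjw : jw ≤ jc)
    (f : ℝ → ℝ) (Lf : ℝ)
    (hfLip : ∀ a b : ℝ, |f a - f b| ≤ Lf * |a - b|)
    (hf0 : f 0 = 0) (hfR : f R = 0)
    (F : ℝ → ℝ → ℝ) (LF : ℝ)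
    (hFLip : ∀ a a' b b' : ℝ, |F a b - F a' b'| ≤ LF * (|a - a'| + |b - b'|))
    (hFcons : ∀ a ∈ Set.Icc (0:ℝ) R, F a a = f a)
    (hFmono1 : ∀ a a' b : ℝ, a ∈ Set.Icc (0:ℝ) R → a' ∈ Set.Icc (0:ℝ) R →
      b ∈ Set.Icc (0:ℝ) R → a ≤ a' → F a b ≤ F a' b)
    (hFmono2 : ∀ a b b' : ℝ, a ∈ Set.Icc (0:ℝ) R → b ∈ Set.Icc (0:ℝ) R →
      b' ∈ Set.Icc (0:ℝ) R → b ≤ b' → F a b' ≤ F a b)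
    (hCFL : LF * Δt / Δx ≤ 1/2)
    (w : ℤ → ℝ) (hw_nonneg : ∀ j, 0 ≤ w j)
    (hw_bdd : BddAbove (Set.range w))
    (hw_supp : ∀ j : ℤ, (j < jw ∨ jc < j) → w j = 0)
    (p : ℝ → ℝ) (Lp : ℝ)
    (hpLip : ∀ x y : ℝ, |p x - p y| ≤ Lp * |x - y|)
    (hp_nonneg : ∀ x : ℝ, 0 ≤ p x)
    (q : ℕ → ℝ) (ρ : ℕ → ℤ → ℝ)
    (hq : ∀ n : ℕ, q n = p (Δx * ∑ j ∈ Finset.Icc jw jc, w j * ρ n j))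
    (hscheme : ∀ n : ℕ, ∀ j : ℤ, ρ (n+1) j =
      ρ n j - (Δt/Δx) *
        ((if j = jc then min (F (ρ n j) (ρ n (j+1))) (q n) else F (ρ n j) (ρ n (j+1)))
          - (if j - 1 = jc then min (F (ρ n (j-1)) (ρ n j)) (q n)
             else F (ρ n (j-1)) (ρ n j))))
    (hinit : ∀ j : ℤ, ρ 0 j ∈ Set.Icc (0:ℝ) R)
    (T : ℝ) (hT : 0 < T)
    (N : ℕ) (hN : N = ⌊T / Δt⌋₊) :
    ∑ n ∈ Finset.range N, |q (n+1) - q n| ≤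
      ((jc - jw + 2 : ℤ) : ℝ) * T * R * Lp * (⨆ j : ℤ, w j) * (LF + Lf) := by
  have hLF : 0 ≤ LF := by
    have := (abs_nonneg _).trans (hFLip 1 0 0 0)
    simpa using this
  have hLf : 0 ≤ Lf := by
    have := (abs_nonneg _).trans (hfLip 1 0)
    simpa using this
  have hLp : 0 ≤ Lp := by
    have := (abs_nonneg _).trans (hpLip 1 0)
    simpa using this
  have m0 : (0:ℝ) ∈ Set.Icc (0:ℝ) R := ⟨le_rfl, hR.le⟩
  have mR : R ∈ Set.Icc (0:ℝ) R := ⟨hR.le, le_rfl⟩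
  have hF00 : F 0 0 = 0 := by rw [hFcons 0 m0, hf0]
  have hFRR : F R R = 0 := by rw [hFcons R mR, hfR]
  -- elementary bounds on the numerical flux
  have u1 : ∀ a ∈ Set.Icc (0:ℝ) R, ∀ b ∈ Set.Icc (0:ℝ) R, F a b ≤ LF * a := by
    intro a ha b hb
    have h1 := hFmono2 a 0 b ha m0 hb hb.1
    have h2 := (abs_le.1 (hFLip a 0 0 0)).2
    simp only [sub_zero, abs_zero, add_zero, hF00, abs_of_nonneg ha.1] at h2
    linarith
  have u2 : ∀ a ∈ Set.Icc (0:ℝ) R, ∀ b ∈ Set.Icc (0:ℝ) R, F a b ≤ LF * (R - b) := by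
    intro a ha b hb
    have h1 := hFmono1 a R b ha mR hb ha.2
    have h2 := (abs_le.1 (hFLip R R b R)).2
    rw [sub_self, abs_zero, zero_add, hFRR, sub_zero, abs_sub_comm,
      abs_of_nonneg (sub_nonneg.2 hb.2)] at h2
    linarith
  have l1 : ∀ a ∈ Set.Icc (0:ℝ) R, ∀ b ∈ Set.Icc (0:ℝ) R, -(LF * b) ≤ F a b := by
    intro a ha b hb
    have h1 := hFmono1 0 a b m0 ha hb ha.1
    have h2 := (abs_le.1 (hFLip 0 0 b 0)).1
    simp only [sub_zero, abs_zero, zero_add, hF00, abs_of_nonneg hb.1] at h2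
    linarith
  have l2 : ∀ a ∈ Set.Icc (0:ℝ) R, ∀ b ∈ Set.Icc (0:ℝ) R, -(LF * (R - a)) ≤ F a b := by
    intro a ha b hb
    have h1 := hFmono2 a b R ha hb mR hb.2
    have h2 := (abs_le.1 (hFLip a R R R)).1
    rw [sub_self, abs_zero, add_zero, hFRR, sub_zero, abs_sub_comm,
      abs_of_nonneg (sub_nonneg.2 ha.2)] at h2
    linarith
  have hq0 : ∀ n, 0 ≤ q n := fun n => by rw [hq n]; exact hp_nonneg _
  -- the (constrained) flux through the right interface of cell `j`
  obtain ⟨G, hGdef⟩ : ∃ G : ℕ → ℤ → ℝ, ∀ n j, G n j =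
      if j = jc then min (F (ρ n j) (ρ n (j+1))) (q n) else F (ρ n j) (ρ n (j+1)) :=
    ⟨_, fun _ _ => rfl⟩
  have hsch : ∀ n j, ρ (n+1) j = ρ n j - (Δt/Δx) * (G n j - G n (j-1)) := by
    intro n j
    rw [hscheme n j, hGdef n j, hGdef n (j-1), sub_add_cancel]
  have hGle : ∀ n j, G n j ≤ F (ρ n j) (ρ n (j+1)) := by
    intro n j
    rw [hGdef]
    split_ifs
    · exact min_le_left _ _
    · exact le_rfl
  have hGge : ∀ n j c, c ≤ 0 → c ≤ F (ρ n j) (ρ n (j+1)) → c ≤ G n j := by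
    intro n j c hc hcF
    rw [hGdef]
    split_ifs
    · exact le_min hcF (hc.trans (hq0 n))
    · exact hcF
  have hlam : 0 < Δt / Δx := div_pos hΔt hΔx
  have hCFL' : LF * (Δt / Δx) ≤ 1/2 := by rw [← mul_div_assoc]; exact hCFL
  -- invariance of `[0,R]`
  have hinv : ∀ n j, ρ n j ∈ Set.Icc (0:ℝ) R := by
    intro n
    induction n with
    | zero => exact hinit
    | succ n ih =>
      intro j
      have hb := ih j
      have gl := hGle n (j-1)
      have gg := hGge n (j-1)
      rw [sub_add_cancel] at gl gg
      have hLb := mul_nonneg hLF hb.1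
      have hLRb := mul_nonneg hLF (sub_nonneg.2 hb.2)
      have a1 : G n j ≤ LF * ρ n j := (hGle n j).trans (u1 _ hb _ (ih _))
      have a2 : -(LF * (R - ρ n j)) ≤ G n j :=
        hGge n j _ (by linarith) (l2 _ hb _ (ih _))
      have a3 : G n (j-1) ≤ LF * (R - ρ n j) := gl.trans (u2 _ (ih _) _ hb)
      have a4 : -(LF * ρ n j) ≤ G n (j-1) := gg _ (by linarith) (l1 _ (ih _) _ hb)
      rw [hsch]
      have b1 : (Δt/Δx) * (G n j - G n (j-1)) ≤ (Δt/Δx) * (2 * (LF * ρ n j)) :=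
        mul_le_mul_of_nonneg_left (by linarith) hlam.le
      have b2 : (Δt/Δx) * (-(2 * (LF * (R - ρ n j)))) ≤ (Δt/Δx) * (G n j - G n (j-1)) :=
        mul_le_mul_of_nonneg_left (by linarith) hlam.le
      have c1 := mul_le_mul_of_nonneg_right hCFL' hb.1
      have c2 := mul_le_mul_of_nonneg_right hCFL' (sub_nonneg.2 hb.2)
      constructor
      · linarith
      · linarith
  have hGabs : ∀ n j, |G n j| ≤ LF * R := by
    intro n j
    have h1 := (hGle n j).trans (u1 _ (hinv n j) _ (hinv n (j+1)))
    have h2 := mul_le_mul_of_nonneg_left (hinv n j).2 hLF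
    have h3 := mul_le_mul_of_nonneg_left (hinv n (j+1)).2 hLF
    have h4 := hGge n j (-(LF * ρ n (j+1)))
      (neg_nonpos.2 (mul_nonneg hLF (hinv n (j+1)).1)) (l1 _ (hinv n j) _ (hinv n (j+1)))
    rw [abs_le]
    constructor <;> linarith
  have hwW : ∀ j, w j ≤ ⨆ j : ℤ, w j := fun j => le_ciSup hw_bdd j
  generalize (⨆ j : ℤ, w j) = W at hwW
  have hW : 0 ≤ W := (hw_nonneg 0).trans (hwW 0)
  have hK : (0:ℝ) ≤ ((jc - jw + 2 : ℤ) : ℝ) := by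
    have : (0:ℤ) ≤ jc - jw + 2 := by omega
    exact_mod_cast this
  have hstep : ∀ n, |q (n+1) - q n| ≤ Lp * (Δt * (((jc - jw + 2 : ℤ) : ℝ) * (W * (LF * R)))) := by
    intro n
    have hab := abel_bound jc jw hjw w (G n) W (LF * R) hw_nonneg hwW hw_supp (hGabs n)
    rw [hq, hq]
    refine (hpLip _ _).trans (mul_le_mul_of_nonneg_left ?_ hLp)
    have e : Δx * ∑ j ∈ Finset.Icc jw jc, w j * ρ (n+1) j
        - Δx * ∑ j ∈ Finset.Icc jw jc, w j * ρ n j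
        = -(Δt * ∑ j ∈ Finset.Icc jw jc, w j * (G n j - G n (j-1))) := by
      rw [← mul_sub, ← Finset.sum_sub_distrib, Finset.mul_sum, Finset.mul_sum,
        ← Finset.sum_neg_distrib]
      apply Finset.sum_congr rfl
      intro j _
      rw [hsch]
      field_simp
      ring
    rw [e, abs_neg, abs_mul, abs_of_pos hΔt]
    exact mul_le_mul_of_nonneg_left hab hΔt.le
  have hNT : (N:ℝ) * Δt ≤ T := by
    rw [← le_div_iff₀ hΔt, hN]
    exact Nat.floor_le (div_pos hT hΔt).le
  calc ∑ n ∈ Finset.range N, |q (n+1) - q n|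
      ≤ ∑ n ∈ Finset.range N, Lp * (Δt * (((jc - jw + 2 : ℤ) : ℝ) * (W * (LF * R)))) :=
        Finset.sum_le_sum fun n _ => hstep n
    _ = ((N:ℝ) * Δt) * (((jc - jw + 2 : ℤ) : ℝ) * R * Lp * W * LF) := by
        rw [Finset.sum_const, nsmul_eq_mul, Finset.card_range]
        ring
    _ ≤ T * (((jc - jw + 2 : ℤ) : ℝ) * R * Lp * W * (LF + Lf)) := by
        apply mul_le_mul hNT _ (by positivity) hT.le
        apply mul_le_mul_of_nonneg_left (by linarith) (by positivity)
    _ = _ := by ring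
end
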